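/- arXiv:0709.4402 — 2 statements merged into one kernel-verified Lean document; each statement's English description precedes it below -/
import Mathlib

section
/- For every k ≥ 1 and every a ∈ A, the Frobenius form restricted to the diagonal satisfies Φ_k(f; a, a, …, a) = k! · ψ_k(f, a). -/
noncomputable section

variable {A B : Type*}

/-- The Frobenius forms `Φ_k(f; a₁, …, a_k)`, defined inductively by `Φ₀ = 1`
(so that `Φ₁(f; a) = f a`) and
`Φ_{k+1}(f; a₁, …, a_{k+1}) = f a₁ · Φ_k(f; a₂, …, a_{k+1})
  − Σ_{i=2}^{k+1} Φ_k(f; a₂, …, a₁·aᵢ, …, a_{k+1})`. -/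
def Phi [CommRing A] [CommRing B] [Algebra ℝ A] [Algebra ℝ B]
    (f : A →ₗ[ℝ] B) : (n : ℕ) → (Fin n → A) → B
  | 0, _ => 1
  | n + 1, a =>
      f (a 0) * Phi f n (fun i => a i.succ) -
        ∑ i : Fin n, Phi f n (Function.update (fun j => a j.succ) i (a 0 * a i.succ))

/-- The coefficients `ψ_k(f, a)` of the characteristic series, defined by `ψ₀ = 1` and,
for `k ≥ 1`, by the recursion `k·ψ_k(f,a) = Σ_{i=1}^{k} (−1)^{i−1} f(aⁱ)·ψ_{k−i}(f,a)`. -/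
def psi [CommRing A] [CommRing B] [Algebra ℝ A] [Algebra ℝ B]
    (f : A →ₗ[ℝ] B) (a : A) : ℕ → B
  | 0 => 1
  | k + 1 =>
      (((k : ℝ) + 1)⁻¹) • ∑ j ∈ Finset.range (k + 1),
        ((-1 : B) ^ j * f (a ^ (j + 1)) * psi f a (k - j))
  decreasing_by exact Nat.lt_succ_of_le (Nat.sub_le k j)

section FrobeniusForms

variable [CommRing A] [CommRing B] [Algebra ℝ A] [Algebra ℝ B]

lemma Phi_cons (f : A →ₗ[ℝ] B) (n : ℕ) (x : A) (c : Fin n → A) :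
    Phi f (n + 1) (Fin.cons x c : Fin (n + 1) → A) =
      f x * Phi f n c - ∑ i : Fin n, Phi f n (Function.update c i (x * c i)) := by
  simp [Phi]

lemma Phi_cons_cons (f : A →ₗ[ℝ] B) (n : ℕ) (x y : A) (c : Fin n → A) :
    Phi f (n + 2) (Fin.cons x (Fin.cons y c : Fin (n + 1) → A) : Fin (n + 2) → A) =
      f x * Phi f (n + 1) (Fin.cons y c : Fin (n + 1) → A) -
        (Phi f (n + 1) (Fin.cons (x * y) c : Fin (n + 1) → A) +
          ∑ i : Fin n,
            Phi f (n + 1) (Fin.cons y (Function.update c i (x * c i)) : Fin (n + 1) → A)) := by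
  rw [Phi_cons, Fin.sum_univ_succ]
  simp [Fin.cons_update]

lemma Phi_cons_swap (f : A →ₗ[ℝ] B) (n : ℕ) (x y : A) (c : Fin n → A) :
    Phi f (n + 2) (Fin.cons x (Fin.cons y c : Fin (n + 1) → A) : Fin (n + 2) → A) =
      Phi f (n + 2) (Fin.cons y (Fin.cons x c : Fin (n + 1) → A) : Fin (n + 2) → A) := by
  have key : ∑ i : Fin n, ∑ j : Fin n,
        Phi f n (Function.update (Function.update c i (x * c i)) j
          (y * Function.update c i (x * c i) j)) =
      ∑ i : Fin n, ∑ j : Fin n,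
        Phi f n (Function.update (Function.update c i (y * c i)) j
          (x * Function.update c i (y * c i) j)) := by
    rw [Finset.sum_comm]
    refine Finset.sum_congr rfl fun i _ => Finset.sum_congr rfl fun j _ => ?_
    by_cases h : i = j
    · subst h
      simp [mul_left_comm]
    · rw [Function.update_of_ne h, Function.update_of_ne (Ne.symm h), Function.update_comm h]
  rw [Phi_cons_cons, Phi_cons_cons, mul_comm y x]
  simp only [Phi_cons f n x, Phi_cons f n y, Finset.sum_sub_distrib, ← Finset.mul_sum]
  rw [key]
  ring

lemma Phi_insertNth (f : A →ₗ[ℝ] B) (n : ℕ) (i : Fin (n + 1)) (x : A) (c : Fin n → A) :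
    Phi f (n + 1) (i.insertNth x c : Fin (n + 1) → A) =
      Phi f (n + 1) (Fin.cons x c : Fin (n + 1) → A) := by
  induction n generalizing x with
  | zero =>
    obtain rfl : i = 0 := Fin.fin_one_eq_zero i
    simp
  | succ n ih =>
    cases i using Fin.cases with
    | zero => simp
    | succ i =>
      cases c using Fin.consCases with
      | _ y d =>
      have hcons : (i.succ.insertNth x (Fin.cons y d : Fin (n + 1) → A) : Fin (n + 2) → A) =
          (Fin.cons y (i.insertNth x d : Fin (n + 1) → A) : Fin (n + 2) → A) := by
        rw [Fin.insertNth_eq_iff]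
        constructor
        · simp
        · ext j
          cases j using Fin.cases <;> simp [Fin.removeNth]
      have hsame : Function.update (i.insertNth x d : Fin (n + 1) → A) i (y * x) =
          (i.insertNth (y * x) d : Fin (n + 1) → A) := by simp
      have hother (l : Fin n) : Function.update (i.insertNth x d : Fin (n + 1) → A)
            (i.succAbove l) (y * d l) =
          (i.insertNth x (Function.update d l (y * d l)) : Fin (n + 1) → A) := by
        simp
      rw [hcons, ← Phi_cons_swap, Phi_cons_cons, Phi_cons, Fin.sum_univ_succAbove _ i]
      simp only [Fin.insertNth_apply_same, Fin.insertNth_apply_succAbove, hsame, hother, ih]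

lemma Phi_update_const (f : A →ₗ[ℝ] B) (n : ℕ) (i : Fin (n + 1)) (x a : A) :
    Phi f (n + 1) (Function.update (fun _ => a) i x) =
      Phi f (n + 1) (Fin.cons x (fun _ => a) : Fin (n + 1) → A) := by
  rw [← Phi_insertNth f n i]
  congr 1
  rw [Fin.eq_insertNth_iff]
  refine ⟨by simp, ?_⟩
  ext j
  simp [Fin.removeNth]

lemma Phi_cons_pow_const (f : A →ₗ[ℝ] B) (a : A) (n m : ℕ)
    (h : ∀ k ≤ n, Phi f k (fun _ => a) = (k.factorial : B) * psi f a k) :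
    Phi f (n + 1) (Fin.cons (a ^ m) (fun _ => a) : Fin (n + 1) → A) =
      (n.factorial : B) * ∑ j ∈ Finset.range (n + 1),
        ((-1 : B) ^ j * f (a ^ (m + j)) * psi f a (n - j)) := by
  induction n generalizing m with
  | zero => simp [Phi, psi]
  | succ n ih =>
    rw [Phi_cons, h _ le_rfl]
    simp only [Phi_update_const, ← pow_succ, Finset.sum_const, Finset.card_univ,
      Fintype.card_fin, ih (m + 1) fun k hk => h k (hk.trans n.le_succ)]
    rw [Finset.sum_range_succ' _ (n + 1)]
    have hsum : ∑ j ∈ Finset.range (n + 1),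
          ((-1 : B) ^ (j + 1) * f (a ^ (m + (j + 1))) * psi f a (n + 1 - (j + 1))) =
        -∑ j ∈ Finset.range (n + 1),
          ((-1 : B) ^ j * f (a ^ (m + 1 + j)) * psi f a (n - j)) := by
      rw [← Finset.sum_neg_distrib]
      refine Finset.sum_congr rfl fun j _ => ?_
      rw [Nat.add_sub_add_right, add_right_comm m 1 j, add_assoc m j 1, pow_succ]
      ring
    rw [hsum, Nat.factorial_succ]
    simp only [pow_zero, add_zero, Nat.sub_zero, nsmul_eq_mul, Nat.cast_mul]
    ring

lemma succ_mul_psi (f : A →ₗ[ℝ] B) (a : A) (k : ℕ) :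
    ((k + 1 : ℕ) : B) * psi f a (k + 1) =
      ∑ j ∈ Finset.range (k + 1), ((-1 : B) ^ j * f (a ^ (j + 1)) * psi f a (k - j)) := by
  have hk : (k : ℝ) + 1 ≠ 0 := by positivity
  rw [psi, ← nsmul_eq_mul, ← Nat.cast_smul_eq_nsmul ℝ, smul_smul, Nat.cast_succ,
    mul_inv_cancel₀ hk, one_smul]

end FrobeniusForms

/-- On the diagonal, the Frobenius form satisfies `Φ_k(f; a, …, a) = k! · ψ_k(f, a)`. -/
theorem Phi_diagonal [CommRing A] [CommRing B] [Algebra ℝ A] [Algebra ℝ B]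
    (f : A →ₗ[ℝ] B) (k : ℕ) (hk : 1 ≤ k) (a : A) :
    Phi f k (fun _ => a) = (k.factorial : B) * psi f a k := by
  clear hk
  induction k using Nat.strong_induction_on with
  | _ k ih =>
  cases k with
  | zero => simp [Phi, psi]
  | succ n =>
    have hconst : (fun _ => a : Fin (n + 1) → A) = Fin.cons (a ^ 1) (fun _ => a) := by
      ext j
      cases j using Fin.cases <;> simp
    rw [hconst, Phi_cons_pow_const f a n 1 fun k hk => ih k (Nat.lt_succ_of_le hk)]
    simp only [add_comm 1]
    rw [← succ_mul_psi, Nat.factorial_succ, Nat.cast_mul]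
    ring

end
end

section
/- Let X be a compact Hausdorff space, let p, q ∈ ℕ, and let x₁,…,x_p, y₁,…,y_q ∈ X. Define the ℝ-linear functional f on C(X,ℝ) by f(a) = Σ_{i=1}^{p} a(x_i) − Σ_{j=1}^{q} a(y_j). Then f(1) = p − q, and for every a ∈ C(X,ℝ) and every k ≥ p − q + 1 (with k ≥ 0), the (q+1)×(q+1) Hankel determinant det[(ψ_{k+i+j}(f,a))_{0 ≤ i,j ≤ q}] vanishes. -/
noncomputable section

variable {A B : Type*}

open PowerSeries in
theorem PowerSeries.eq_zero_of_derivative_eq_mul {D S : PowerSeries ℝ}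
    (h : derivative ℝ D = D * S) (h0 : coeff 0 D = 0) : D = 0 := by
  ext n
  induction n using Nat.strong_induction_on with
  | _ n ih =>
    cases n with
    | zero => simpa using h0
    | succ n =>
      have hn := congrArg (coeff n) h
      rw [coeff_derivative, coeff_mul, Finset.sum_eq_zero] at hn
      · have : ((n : ℝ) + 1) ≠ 0 := by positivity
        simpa [this] using hn
      · intro ij hij
        have := Finset.HasAntidiagonal.mem_antidiagonal.1 hij
        rw [ih ij.1 (by omega)]
        simp

open PowerSeries in
/-- The logarithmic derivative of `1 + x t`. -/
def logDerivLinear (x : ℝ) : PowerSeries ℝ := mk fun n => (-1) ^ n * x ^ (n + 1)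

open PowerSeries in
theorem one_add_mul_logDerivLinear (x : ℝ) :
    (1 + C x * X) * logDerivLinear x = C x := by
  ext n
  cases n with
  | zero => simp [add_mul, mul_assoc, logDerivLinear]
  | succ n =>
    rw [add_mul, one_mul, mul_assoc, map_add, coeff_C_mul, coeff_succ_X_mul]
    simp [logDerivLinear]
    ring

open PowerSeries in
theorem derivative_prod_one_add {ι : Type*} (s : Finset ι) (x : ι → ℝ) :
    derivative ℝ (∏ i ∈ s, (1 + C (x i) * X)) =
      (∏ i ∈ s, (1 + C (x i) * X)) * ∑ i ∈ s, logDerivLinear (x i) := by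
  classical
  induction s using Finset.induction_on with
  | empty => simp
  | insert i s hi ih =>
    have hd : derivative ℝ (1 + C (x i) * X : PowerSeries ℝ) = C (x i) := by
      simp [Derivation.leibniz]
    rw [Finset.prod_insert hi, Finset.sum_insert hi, Derivation.leibniz, ih, hd, smul_eq_mul,
      smul_eq_mul]
    linear_combination (-∏ i ∈ s, (1 + C (x i) * X)) * one_add_mul_logDerivLinear (x i)

open PowerSeries in
theorem coeff_prod_one_add_eq_zero {ι : Type*} (s : Finset ι) (x : ι → ℝ) {n : ℕ}
    (hn : s.card < n) : coeff n (∏ i ∈ s, (1 + C (x i) * X)) = 0 := by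
  classical
  induction s using Finset.induction_on generalizing n with
  | empty => simp [coeff_one, show n ≠ 0 by simp at hn; omega]
  | insert i s hi ih =>
    rw [Finset.card_insert_of_notMem hi] at hn
    obtain ⟨m, rfl⟩ : ∃ m, n = m + 1 := ⟨n - 1, by omega⟩
    rw [Finset.prod_insert hi, add_mul, one_mul, mul_assoc, map_add, coeff_C_mul,
      coeff_succ_X_mul, ih (by omega), ih (by omega)]
    simp

open PowerSeries in
theorem derivative_mk_psi [CommRing A] [Algebra ℝ A] (f : A →ₗ[ℝ] ℝ) (a : A) :
    derivative ℝ (mk (psi f a)) = mk (psi f a) * mk fun n => (-1) ^ n * f (a ^ (n + 1)) := by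
  ext n
  have hn : ((n : ℝ) + 1) ≠ 0 := by positivity
  rw [coeff_derivative, mul_comm (mk _) (mk _), coeff_mul,
    Finset.Nat.sum_antidiagonal_eq_sum_range_succ_mk, coeff_mk, psi]
  simp only [coeff_mk, smul_eq_mul]
  field_simp

/-- For the functional `f(a) = Σᵢ a(xᵢ) − Σⱼ a(yⱼ)` on `C(X, ℝ)` (`X` compact
Hausdorff), one has `f 1 = p − q` and all the `(q+1) × (q+1)` Hankel determinants
`det (ψ_{k+i+j}(f,a))` with `k ≥ p − q + 1` vanish. -/
theorem eval_diff_hankel_vanish (X : Type*) [TopologicalSpace X] [CompactSpace X]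
    [T2Space X] (p q : ℕ) (x : Fin p → X) (y : Fin q → X) (f : C(X, ℝ) →ₗ[ℝ] ℝ)
    (hf : ∀ a : C(X, ℝ), f a = ∑ i : Fin p, a (x i) - ∑ j : Fin q, a (y j)) :
    f 1 = (p : ℝ) - (q : ℝ) ∧
      ∀ a : C(X, ℝ), ∀ k : ℕ, (p : ℤ) - (q : ℤ) + 1 ≤ (k : ℤ) →
        (Matrix.of fun i j : Fin (q + 1) => psi f a (k + (i : ℕ) + (j : ℕ))).det = 0 := by
  refine ⟨by simp [hf], fun a k hk => ?_⟩
  set P : PowerSeries ℝ := ∏ i, (1 + PowerSeries.C (a (x i)) * PowerSeries.X) with hP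
  set Q : PowerSeries ℝ := ∏ j, (1 + PowerSeries.C (a (y j)) * PowerSeries.X) with hQ
  have hS : (PowerSeries.mk fun n => (-1) ^ n * f (a ^ (n + 1))) =
      ∑ i, logDerivLinear (a (x i)) - ∑ j, logDerivLinear (a (y j)) := by
    ext n
    simp [logDerivLinear, hf, mul_sub, Finset.mul_sum]
  have hQ0 : PowerSeries.coeff 0 Q = 1 := by simp [hQ, map_prod]
  have hP0 : PowerSeries.coeff 0 P = 1 := by simp [hP, map_prod]
  have hQP : Q * PowerSeries.mk (psi f a) = P := by
    refine sub_eq_zero.1 (PowerSeries.eq_zero_of_derivative_eq_mul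
      (S := ∑ i, logDerivLinear (a (x i))) ?_ ?_)
    · rw [map_sub, Derivation.leibniz, derivative_mk_psi, hS, hP, hQ, derivative_prod_one_add,
        derivative_prod_one_add, smul_eq_mul, smul_eq_mul]
      ring
    · rw [map_sub, PowerSeries.coeff_mul]
      simp only [Finset.Nat.antidiagonal_zero, Finset.sum_singleton, hQ0, hP0]
      simp [psi]
  refine Matrix.exists_mulVec_eq_zero_iff.1
    ⟨fun j => PowerSeries.coeff (q - (j : ℕ)) Q, fun h => ?_, ?_⟩
  · simpa [hQ0] using congrFun h (Fin.last q)
  · ext i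
    have hc : PowerSeries.coeff (k + i + q) (Q * PowerSeries.mk (psi f a)) = 0 := by
      rw [hQP]
      exact coeff_prod_one_add_eq_zero _ _ (by simp; omega)
    rw [PowerSeries.coeff_mul, Finset.Nat.sum_antidiagonal_eq_sum_range_succ_mk,
      ← Finset.sum_subset (Finset.range_mono (show q + 1 ≤ (k + i + q).succ by omega)),
      ← Finset.sum_range_reflect] at hc
    · simp only [Matrix.mulVec, dotProduct, Matrix.of_apply, Pi.zero_apply]
      rw [← hc, Fin.sum_univ_eq_sum_range
        (fun j => psi f a (k + i + j) * PowerSeries.coeff (q - j) Q)]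
      refine Finset.sum_congr rfl fun j hj => ?_
      have := Finset.mem_range.1 hj
      rw [PowerSeries.coeff_mk, mul_comm, show q + 1 - 1 - j = q - j by omega,
        show k + i + q - (q - j) = k + i + j by omega]
    · intro n _ hn
      rw [coeff_prod_one_add_eq_zero _ _ (by simpa using hn), zero_mul]

end
end
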